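/- Let χ be a mixed stopping time, P a probability measure on Ω, and X, Y, S adapted real processes such that for every t = 0,...,T: χ*_t Y_t = χ*_{t+1} X_t + χ_t S_t, and for every t = 1,...,T: X_{t−1} = E_P(Y_t | F_{t−1}) P-almost surely. Then for every t = 0,...,T one has χ*_{t+1} X_t = E_P(S^{χ*}_{t+1} | F_t) P-almost surely. -/

import Mathlib

open MeasureTheory
open scoped Pointwise

noncomputable section

namespace RZ

variable {Ω : Type*} [Fintype Ω]

/-- `ω` and `ω'` lie in the same atom of the σ-field `m`. -/
def sameAtom (m : MeasurableSpace Ω) (ω ω' : Ω) : Prop :=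
  ∀ A : Set Ω, MeasurableSet[m] A → (ω ∈ A ↔ ω' ∈ A)

/-- Elementary conditional expectation w.r.t. a σ-field on a finite space:
at `ω` it is the `P`-average of `f` over the atom of `ω`. -/
def condExp (m : MeasurableSpace Ω) (P : Ω → ℝ) (f : Ω → ℝ) (ω : Ω) : ℝ :=
  (∑ ω' : Ω, Set.indicator {ω'' | sameAtom m ω ω''} (fun ω'' => P ω'' * f ω'') ω') /
  (∑ ω' : Ω, Set.indicator {ω'' | sameAtom m ω ω''} P ω')

/-- Expectation under `P`. -/
def expect (P : Ω → ℝ) (f : Ω → ℝ) : ℝ := ∑ ω : Ω, P ω * f ω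

/-- Discrete market model with proportional transaction costs. -/
structure Market (Ω : Type*) [Fintype Ω] where
  T : ℕ
  T_pos : 0 < T
  F : ℕ → MeasurableSpace Ω
  F_mono : ∀ ⦃s t : ℕ⦄, s ≤ t → F s ≤ F t
  F_zero : F 0 = ⊥
  F_top : F T = ⊤
  Q : Ω → ℝ
  Q_pos : ∀ ω, 0 < Q ω
  Q_sum : ∑ ω, Q ω = 1
  Sb : ℕ → Ω → ℝ
  Sa : ℕ → Ω → ℝ
  Sb_pos : ∀ t ω, t ≤ T → 0 < Sb t ω
  Sb_le_Sa : ∀ t ω, t ≤ T → Sb t ω ≤ Sa t ω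
  Sb_adapted : ∀ t, t ≤ T → Measurable[F t] (Sb t)
  Sa_adapted : ∀ t, t ≤ T → Measurable[F t] (Sa t)

variable (M : Market Ω)

/-- Liquidation value θ_t(γ, δ) in scenario ω, for a cash position γ and stock position δ. -/
def liq (t : ℕ) (ω : Ω) (γ δ : ℝ) : ℝ :=
  γ + M.Sb t ω * max δ 0 - M.Sa t ω * max (-δ) 0

/-- An adapted (real-valued) process. -/
def IsAdapted (X : ℕ → Ω → ℝ) : Prop := ∀ t, t ≤ M.T → Measurable[M.F t] (X t)

/-- An adapted ℝ²-valued payoff process. -/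
def AdaptedPair (ξ ζ : ℕ → Ω → ℝ) : Prop := IsAdapted M ξ ∧ IsAdapted M ζ

/-- Self-financing strategy. -/
def SelfFinancing (α β : ℕ → Ω → ℝ) : Prop :=
  Measurable[M.F 0] (α 0) ∧ Measurable[M.F 0] (β 0) ∧
  (∀ t, t < M.T → Measurable[M.F t] (α (t + 1)) ∧ Measurable[M.F t] (β (t + 1))) ∧
  (∀ t, t < M.T → ∀ ω, 0 ≤ liq M t ω (α t ω - α (t + 1) ω) (β t ω - β (t + 1) ω))

/-- Pure stopping time with values in {0,...,T}. -/
def IsStop (τ : Ω → ℕ) : Prop :=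
  (∀ ω, τ ω ≤ M.T) ∧ ∀ t : ℕ, MeasurableSet[M.F t] {ω | τ ω = t}

/-- Seller superhedging strategy. -/
def SellerHedge (ξ ζ α β : ℕ → Ω → ℝ) : Prop :=
  SelfFinancing M α β ∧
  ∀ τ, IsStop M τ → ∀ ω,
    0 ≤ liq M (τ ω) ω (α (τ ω) ω - ξ (τ ω) ω) (β (τ ω) ω - ζ (τ ω) ω)

/-- Buyer superhedging strategy. -/
def BuyerHedge (ξ ζ α β : ℕ → Ω → ℝ) : Prop :=
  SelfFinancing M α β ∧
  ∃ τ, IsStop M τ ∧ ∀ ω,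
    0 ≤ liq M (τ ω) ω (α (τ ω) ω + ξ (τ ω) ω) (β (τ ω) ω + ζ (τ ω) ω)

/-- Seller's (ask) price: infimum of the initial costs of seller superhedging strategies. -/
def askPrice (ξ ζ : ℕ → Ω → ℝ) : ℝ :=
  sInf {x | ∃ α β, SellerHedge M ξ ζ α β ∧ ∀ ω, x = -liq M 0 ω (-α 0 ω) (-β 0 ω)}

/-- Buyer's (bid) price: supremum of the amounts raised by buyer superhedging strategies. -/
def bidPrice (ξ ζ : ℕ → Ω → ℝ) : ℝ :=
  sSup {x | ∃ α β, BuyerHedge M ξ ζ α β ∧ ∀ ω, x = liq M 0 ω (-α 0 ω) (-β 0 ω)}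

/-- Mixed stopping time. -/
def IsMixedStop (χ : ℕ → Ω → ℝ) : Prop :=
  (∀ t, t ≤ M.T → Measurable[M.F t] (χ t)) ∧ (∀ t ω, 0 ≤ χ t ω) ∧
  ∀ ω, ∑ t ∈ Finset.range (M.T + 1), χ t ω = 1

/-- χ*_t = Σ_{s=t}^T χ_s  (so χ*_{T+1} = 0). -/
def chiStar (χ : ℕ → Ω → ℝ) (t : ℕ) (ω : Ω) : ℝ := ∑ s ∈ Finset.Icc t M.T, χ s ω

/-- Z^{χ*}_t = Σ_{s=t}^T χ_s Z_s  (so Z^{χ*}_{T+1} = 0). -/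
def starVal (χ Z : ℕ → Ω → ℝ) (t : ℕ) (ω : Ω) : ℝ :=
  ∑ s ∈ Finset.Icc t M.T, χ s ω * Z s ω

/-- Z_χ = Σ_{t=0}^T χ_t Z_t. -/
def mixVal (χ Z : ℕ → Ω → ℝ) (ω : Ω) : ℝ :=
  ∑ t ∈ Finset.range (M.T + 1), χ t ω * Z t ω

/-- Membership in the family barP(χ). -/
def memBarP (χ : ℕ → Ω → ℝ) (P : Ω → ℝ) (S : ℕ → Ω → ℝ) : Prop :=
  (∀ ω, 0 ≤ P ω) ∧ (∑ ω, P ω) = 1 ∧ IsAdapted M S ∧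
  (∀ t ω, t ≤ M.T → M.Sb t ω ≤ S t ω ∧ S t ω ≤ M.Sa t ω) ∧
  (∀ t, t ≤ M.T → ∀ ω, 0 < P ω →
    chiStar M χ (t + 1) ω * M.Sb t ω ≤ condExp (M.F t) P (starVal M χ S (t + 1)) ω ∧
    condExp (M.F t) P (starVal M χ S (t + 1)) ω ≤ chiStar M χ (t + 1) ω * M.Sa t ω)

/-- Membership in the family P(χ): barP(χ) with P equivalent to Q. -/
def memP (χ : ℕ → Ω → ℝ) (P : Ω → ℝ) (S : ℕ → Ω → ℝ) : Prop :=
  memBarP M χ P S ∧ ∀ ω, 0 < P ω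

/-- The mixed stopping time χ^τ associated with a pure stopping time τ. -/
def pureChi (τ : Ω → ℕ) : ℕ → Ω → ℝ := fun t ω => if τ ω = t then 1 else 0

/-- Arbitrage-free: there is an equivalent probability measure and a martingale
between the bid and ask prices. -/
def ArbitrageFree : Prop :=
  ∃ (P : Ω → ℝ) (S : ℕ → Ω → ℝ),
    (∀ ω, 0 < P ω) ∧ (∑ ω, P ω) = 1 ∧ IsAdapted M S ∧
    (∀ t ω, t ≤ M.T → M.Sb t ω ≤ S t ω ∧ S t ω ≤ M.Sa t ω) ∧
    (∀ t, t < M.T → ∀ ω, 0 < P ω → condExp (M.F t) P (S (t + 1)) ω = S t ω)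

/-- Epigraph of a function ℝ → ℝ, as a subset of ℝ² (first coordinate dominates). -/
def epi (f : ℝ → ℝ) : Set (ℝ × ℝ) := {p | f p.2 ≤ p.1}

/-- The function h_{[b,a]}(y) = a y⁻ − b y⁺. -/
def hfun (b a : ℝ) (y : ℝ) : ℝ := a * max (-y) 0 - b * max y 0

/-- Seller's payoff function u_t(y) = ξ_t + (y − ζ_t)⁻ S^a_t − (y − ζ_t)⁺ S^b_t. -/
def uSell (ξ ζ : ℕ → Ω → ℝ) (t : ℕ) (ω : Ω) (y : ℝ) : ℝ :=
  ξ t ω + M.Sa t ω * max (ζ t ω - y) 0 - M.Sb t ω * max (y - ζ t ω) 0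

/-- Buyer's payoff function u_t(y) = −ξ_t + (y + ζ_t)⁻ S^a_t − (y + ζ_t)⁺ S^b_t. -/
def uBuy (ξ ζ : ℕ → Ω → ℝ) (t : ℕ) (ω : Ω) (y : ℝ) : ℝ :=
  -ξ t ω + M.Sa t ω * max (-(y + ζ t ω)) 0 - M.Sb t ω * max (y + ζ t ω) 0

/-- The seller's pricing recursion: one function per atom,
`z_T = u_T` and `epi z_{t-1} = epi u_{t-1} ∩ (epi h + ⋂_{succ} epi z_t)`. -/
def SellerRec (ξ ζ : ℕ → Ω → ℝ) (z : ℕ → Ω → ℝ → ℝ) : Prop :=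
  (∀ t ω ω', t ≤ M.T → sameAtom (M.F t) ω ω' → z t ω = z t ω') ∧
  (∀ ω, z M.T ω = uSell M ξ ζ M.T ω) ∧
  (∀ t ω, t < M.T →
    epi (z t ω) = epi (uSell M ξ ζ t ω) ∩
      (epi (hfun (M.Sb t ω) (M.Sa t ω)) +
        ⋂ ω' ∈ {ω'' | sameAtom (M.F t) ω ω''}, epi (z (t + 1) ω')))

/-- The buyer's pricing recursion: one function per atom,
`z_T = u_T` and `epi z_{t-1} = epi u_{t-1} ∪ (epi h + ⋂_{succ} epi z_t)`. -/
def BuyerRec (ξ ζ : ℕ → Ω → ℝ) (z : ℕ → Ω → ℝ → ℝ) : Prop :=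
  (∀ t ω ω', t ≤ M.T → sameAtom (M.F t) ω ω' → z t ω = z t ω') ∧
  (∀ ω, z M.T ω = uBuy M ξ ζ M.T ω) ∧
  (∀ t ω, t < M.T →
    epi (z t ω) = epi (uBuy M ξ ζ t ω) ∪
      (epi (hfun (M.Sb t ω) (M.Sa t ω)) +
        ⋂ ω' ∈ {ω'' | sameAtom (M.F t) ω ω''}, epi (z (t + 1) ω')))

theorem sameAtom_refl {α : Type*} (m : MeasurableSpace α) (x : α) : sameAtom m x x :=
  fun _ _ => Iff.rfl

theorem sameAtom.symm {α : Type*} {m : MeasurableSpace α} {x y : α} (h : sameAtom m x y) :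
    sameAtom m y x := fun A hA => (h A hA).symm

theorem sameAtom.trans {α : Type*} {m : MeasurableSpace α} {x y z : α} (h : sameAtom m x y)
    (h' : sameAtom m y z) : sameAtom m x z := fun A hA => (h A hA).trans (h' A hA)

theorem sameAtom.mono {α : Type*} {m m' : MeasurableSpace α} (hm : m ≤ m') {x y : α}
    (h : sameAtom m' x y) : sameAtom m x y := fun A hA => h A (hm A hA)

/-- Measurable functions are constant on atoms. -/
theorem sameAtom.apply_eq {α : Type*} {m : MeasurableSpace α} {x y : α} (h : sameAtom m x y)
    {f : α → ℝ} (hf : Measurable[m] f) : f x = f y :=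
  ((h (f ⁻¹' {f x}) (hf (measurableSet_singleton _))).1 rfl).symm

theorem sameAtom.setOf_eq {α : Type*} {m : MeasurableSpace α} {x y : α} (h : sameAtom m x y) :
    {z | sameAtom m x z} = {z | sameAtom m y z} :=
  Set.ext fun _ => ⟨h.symm.trans, h.trans⟩

/-- Almost surely equal functions have the same conditional expectation. -/
theorem condExp_congr (m : MeasurableSpace Ω) {P : Ω → ℝ} (hP : ∀ ω, 0 ≤ P ω) {f g : Ω → ℝ}
    (h : ∀ ω, 0 < P ω → f ω = g ω) (ω : Ω) : condExp m P f ω = condExp m P g ω := by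
  have hfg : (fun x => P x * f x) = fun x => P x * g x := by
    funext x
    rcases (hP x).eq_or_lt with h0 | h0
    · simp [← h0]
    · rw [h x h0]
  simp only [condExp, hfg]

theorem condExp_add (m : MeasurableSpace Ω) (P f g : Ω → ℝ) (ω : Ω) :
    condExp m P (fun x => f x + g x) ω = condExp m P f ω + condExp m P g ω := by
  simp only [condExp, ← add_div, ← Finset.sum_add_distrib, ← Set.indicator_add, mul_add]

/-- A factor that is constant on the atom can be pulled out. -/
theorem mul_condExp (m : MeasurableSpace Ω) (P f g : Ω → ℝ) (ω : Ω)
    (hg : ∀ ω', sameAtom m ω ω' → g ω = g ω') :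
    g ω * condExp m P f ω = condExp m P (fun x => g x * f x) ω := by
  classical
  simp only [condExp, ← mul_div_assoc, Finset.mul_sum, Set.indicator_apply, Set.mem_ofPred_eq]
  congr 1
  refine Finset.sum_congr rfl fun x _ => ?_
  split_ifs with hx
  · rw [hg x hx]; ring
  · simp

/-- The tower property. -/
theorem condExp_condExp {m m' : MeasurableSpace Ω} (hm : m ≤ m') {P : Ω → ℝ}
    (hP : ∀ ω, 0 ≤ P ω) (f : Ω → ℝ) (ω : Ω) :
    condExp m P (condExp m' P f) ω = condExp m P f ω := by
  classical
  set d : Ω → ℝ := fun x => ∑ y, Set.indicator {z | sameAtom m' x z} P y with hd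
  have hd_eq : ∀ {x y}, sameAtom m' x y → d x = d y := fun h => by simp only [hd, h.setOf_eq]
  have hP_le : ∀ x, P x ≤ d x := fun x => by
    refine le_trans (le_of_eq ?_) (Finset.single_le_sum
      (fun y _ => Set.indicator_nonneg (fun z _ => hP z) y) (Finset.mem_univ x))
    rw [Set.indicator_of_mem (show x ∈ {z | sameAtom m' x z} from sameAtom_refl m' x)]
  have key : ∑ x, Set.indicator {z | sameAtom m ω z} (fun z => P z * condExp m' P f z) x =
      ∑ x, Set.indicator {z | sameAtom m ω z} (fun z => P z * f z) x := by
    calc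
      _ = ∑ x, ∑ y, Set.indicator {z | sameAtom m ω z} (fun z => P z * f z) y *
            (Set.indicator {z | sameAtom m' y z} P x / d y) := by
        refine Finset.sum_congr rfl fun x _ => ?_
        have hx : condExp m' P f x =
          (∑ y, Set.indicator {z | sameAtom m' x z} (fun z => P z * f z) y) / d x := rfl
        simp only [Set.indicator_apply, Set.mem_ofPred_eq, hx, Finset.sum_div, Finset.mul_sum]
        by_cases h : sameAtom m ω x
        · rw [if_pos h]
          refine Finset.sum_congr rfl fun y _ => ?_
          by_cases hxy : sameAtom m' x y
          · rw [if_pos hxy, if_pos (h.trans (hxy.mono hm)), if_pos hxy.symm, hd_eq hxy]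
            ring
          · rw [if_neg hxy, if_neg (c := sameAtom m' y x) fun hyx => hxy hyx.symm]
            simp
        · rw [if_neg h]
          refine (Finset.sum_eq_zero fun y _ => ?_).symm
          by_cases hyx : sameAtom m' y x
          · rw [if_neg fun hy => h (hy.trans (hyx.mono hm))]
            simp
          · rw [if_neg hyx]
            simp
      _ = _ := by
        rw [Finset.sum_comm]
        refine Finset.sum_congr rfl fun y _ => ?_
        rw [← Finset.mul_sum, ← Finset.sum_div]
        change _ * (d y / d y) = _
        by_cases h : d y = 0
        · have hy : P y = 0 := le_antisymm (h ▸ hP_le y) (hP y)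
          simp [Set.indicator_apply, hy]
        · rw [div_self h, mul_one]
  rw [condExp, key, condExp]

/-- If χ*_t Y_t = χ*_{t+1} X_t + χ_t S_t for all t and X_{t−1} = E_P(Y_t | F_{t−1})
P-a.s. for t = 1,...,T, then χ*_{t+1} X_t = E_P(S^{χ*}_{t+1} | F_t) P-a.s. for all t. -/
theorem chiStar_conditional_identity (T : ℕ) (hT : 0 < T)
    (F : ℕ → MeasurableSpace Ω) (hmono : ∀ ⦃s t : ℕ⦄, s ≤ t → F s ≤ F t)
    (hF0 : F 0 = ⊥) (hFT : F T = ⊤)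
    (χ : ℕ → Ω → ℝ) (hχ_adapted : ∀ t, t ≤ T → Measurable[F t] (χ t))
    (hχ_nonneg : ∀ t ω, 0 ≤ χ t ω)
    (hχ_sum : ∀ ω, ∑ t ∈ Finset.range (T + 1), χ t ω = 1)
    (P : Ω → ℝ) (hP0 : ∀ ω, 0 ≤ P ω) (hP1 : (∑ ω, P ω) = 1)
    (X Y S : ℕ → Ω → ℝ)
    (hX : ∀ t, t ≤ T → Measurable[F t] (X t))
    (hY : ∀ t, t ≤ T → Measurable[F t] (Y t))
    (hS : ∀ t, t ≤ T → Measurable[F t] (S t))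
    (h1 : ∀ t ω, t ≤ T → (∑ s ∈ Finset.Icc t T, χ s ω) * Y t ω =
        (∑ s ∈ Finset.Icc (t + 1) T, χ s ω) * X t ω + χ t ω * S t ω)
    (h2 : ∀ t, 1 ≤ t → t ≤ T → ∀ ω, 0 < P ω →
        X (t - 1) ω = condExp (F (t - 1)) P (Y t) ω) :
    ∀ t, t ≤ T → ∀ ω, 0 < P ω →
      (∑ s ∈ Finset.Icc (t + 1) T, χ s ω) * X t ω =
        condExp (F t) P (fun ω' => ∑ s ∈ Finset.Icc (t + 1) T, χ s ω' * S s ω') ω := by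
  have hstar : ∀ t, t ≤ T → ∀ ω ω', sameAtom (F t) ω ω' →
      ∑ s ∈ Finset.Icc (t + 1) T, χ s ω = ∑ s ∈ Finset.Icc (t + 1) T, χ s ω' := by
    intro t ht ω ω' h
    have hsplit : ∀ x, ∑ s ∈ Finset.range (t + 1), χ s x +
        ∑ s ∈ Finset.Icc (t + 1) T, χ s x = 1 := fun x => by
      rw [← hχ_sum x, ← Finset.sum_range_add_sum_Ico _ (Nat.succ_le_succ ht)]
      rfl
    have hpast : ∑ s ∈ Finset.range (t + 1), χ s ω = ∑ s ∈ Finset.range (t + 1), χ s ω' :=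
      Finset.sum_congr rfl fun s hs => by
        have hst : s ≤ t := Nat.lt_succ_iff.1 (Finset.mem_range.1 hs)
        exact (h.mono (hmono hst)).apply_eq (hχ_adapted s (hst.trans ht))
    linarith [hsplit ω, hsplit ω']
  intro t ht
  induction ht using Nat.decreasingInduction with
  | self => intro ω _; simp [condExp]
  | of_succ t ht ih =>
    intro ω hω
    have hX_eq : X t ω = condExp (F t) P (Y (t + 1)) ω := h2 (t + 1) (by omega) ht ω hω
    have hcons : ∀ Z : ℕ → ℝ, ∑ s ∈ Finset.Icc (t + 1) T, Z s =
        ∑ s ∈ Finset.Icc (t + 1 + 1) T, Z s + Z (t + 1) := fun Z => by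
      rw [← Finset.add_sum_Ioc_eq_sum_Icc ht, add_comm, Finset.Icc_add_one_left_eq_Ioc]
    rw [hX_eq, mul_condExp (F t) P (Y (t + 1)) (fun x => ∑ s ∈ Finset.Icc (t + 1) T, χ s x) ω
      (hstar t ht.le ω)]
    simp only [h1 (t + 1) _ ht, hcons (fun s => χ s _ * S s _)]
    rw [condExp_add, condExp_add, condExp_congr (F t) hP0 ih,
      condExp_condExp (hmono t.le_succ) hP0]

end RZ
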